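/- (Multivariate q-Cauchy formula.) Let n ≥ 1 and k ≥ 1 be integers, let q > 0 be real with q ≠ 1, and let x_1,…,x_{k+1} be real numbers. Then [x_1+x_2+⋯+x_{k+1}; n]_q = Σ q^{Σ_{j=1}^{k}(n−s_j)(x_j−r_j)} · ∏_{j=1}^{k+1}[x_j; r_j]_q, where the sum is over all nonnegative integers r_1,…,r_k with r_1+⋯+r_k ≤ n, s_j = r_1+⋯+r_j, r_{k+1} = n − s_k, and q raised to a real exponent denotes the real power. -/

import Mathlib

open Finset Filter

noncomputable def qNum (q x : ℝ) : ℝ := (1 - q ^ x) / (1 - q)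

noncomputable def qFact (q x : ℝ) (r : ℕ) : ℝ :=
  ∏ i ∈ Finset.range r, qNum q (x - i)

noncomputable def qFactorial (q : ℝ) (r : ℕ) : ℝ :=
  ∏ i ∈ Finset.range r, qNum q (i + 1)

noncomputable def qBinom (q x : ℝ) (r : ℕ) : ℝ := qFact q x r / qFactorial q r

noncomputable def qMultinom {k : ℕ} (q x : ℝ) (r : Fin k → ℕ) : ℝ :=
  qFact q x (∑ i, r i) / ∏ i, qFactorial q (r i)

theorem qNum_add {q : ℝ} (hq0 : 0 < q) (a b : ℝ) :
    qNum q (a + b) = qNum q a + q ^ a * qNum q b := by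
  unfold qNum
  rw [Real.rpow_add hq0]
  ring

theorem qNum_natCast_succ_ne_zero {q : ℝ} (hq0 : 0 < q) (hq1 : q ≠ 1) (n : ℕ) :
    qNum q (n + 1) ≠ 0 := by
  unfold qNum
  refine div_ne_zero (sub_ne_zero.2 fun h => ?_) (sub_ne_zero.2 hq1.symm)
  exact hq1 ((Real.rpow_left_inj hq0.le zero_le_one (by positivity)).1
    (h.symm.trans (Real.one_rpow ((n : ℝ) + 1)).symm))

theorem qNum_zero (q : ℝ) : qNum q 0 = 0 := by
  simp [qNum]

theorem qBinom_zero (q x : ℝ) : qBinom q x 0 = 1 := by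
  simp [qBinom, qFact, qFactorial]

theorem qNum_mul_qBinom_succ {q : ℝ} (hq0 : 0 < q) (hq1 : q ≠ 1) (x : ℝ) (n : ℕ) :
    qNum q (n + 1) * qBinom q x (n + 1) = qNum q (x - n) * qBinom q x n := by
  have h := qNum_natCast_succ_ne_zero hq0 hq1 n
  simp only [qBinom, qFact, qFactorial, Finset.prod_range_succ]
  rw [mul_div_assoc', mul_comm (∏ i ∈ Finset.range n, qNum q (i + 1)) (qNum q (n + 1)),
    mul_div_mul_left _ _ h]
  ring

theorem qBinom_add {q : ℝ} (hq0 : 0 < q) (hq1 : q ≠ 1) (x y : ℝ) (n : ℕ) :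
    qBinom q (x + y) n =
      ∑ p ∈ Finset.HasAntidiagonal.antidiagonal n,
        q ^ ((p.2 : ℝ) * (x - p.1)) * (qBinom q x p.1 * qBinom q y p.2) := by
  induction n with
  | zero => simp [qBinom_zero]
  | succ n ih =>
    have h := qNum_natCast_succ_ne_zero hq0 hq1 n
    refine mul_left_cancel₀ h ?_
    rw [qNum_mul_qBinom_succ hq0 hq1, ih, Finset.mul_sum]
    have hleft : ∑ p ∈ Finset.HasAntidiagonal.antidiagonal (n + 1), q ^ ((p.2 : ℝ) * (x - p.1)) *
          (q ^ (p.2 : ℝ) * (qNum q p.1 * qBinom q x p.1) * qBinom q y p.2) =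
        ∑ p ∈ Finset.HasAntidiagonal.antidiagonal n, q ^ ((p.2 : ℝ) * (x - p.1)) *
          (qNum q (x - p.1) * qBinom q x p.1 * qBinom q y p.2) := by
      rw [Finset.Nat.sum_antidiagonal_succ]
      simp only [Nat.cast_zero, qNum_zero, zero_mul, mul_zero, zero_add]
      refine Finset.sum_congr rfl fun p _ => ?_
      push_cast
      rw [qNum_mul_qBinom_succ hq0 hq1, mul_assoc (q ^ (p.2 : ℝ)), ← mul_assoc,
        ← Real.rpow_add hq0]
      congr 2
      ring
    have hright : ∑ p ∈ Finset.HasAntidiagonal.antidiagonal (n + 1), q ^ ((p.2 : ℝ) * (x - p.1)) *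
          (qBinom q x p.1 * (qNum q p.2 * qBinom q y p.2)) =
        ∑ p ∈ Finset.HasAntidiagonal.antidiagonal n, q ^ ((p.2 : ℝ) * (x - p.1)) *
          (qBinom q x p.1 * (q ^ (x - p.1) * (qNum q (y - p.2) * qBinom q y p.2))) := by
      rw [Finset.Nat.sum_antidiagonal_succ']
      simp only [Nat.cast_zero, qNum_zero, zero_mul, mul_zero, zero_add]
      refine Finset.sum_congr rfl fun p _ => ?_
      push_cast
      rw [qNum_mul_qBinom_succ hq0 hq1, add_mul, one_mul, Real.rpow_add hq0]
      ring
    trans ∑ p ∈ Finset.HasAntidiagonal.antidiagonal n, q ^ ((p.2 : ℝ) * (x - p.1)) *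
          (qNum q (x - p.1) * qBinom q x p.1 * qBinom q y p.2) +
        ∑ p ∈ Finset.HasAntidiagonal.antidiagonal n, q ^ ((p.2 : ℝ) * (x - p.1)) *
          (qBinom q x p.1 * (q ^ (x - p.1) * (qNum q (y - p.2) * qBinom q y p.2)))
    · rw [← Finset.sum_add_distrib]
      refine Finset.sum_congr rfl fun p hp => ?_
      have hn : (n : ℝ) = p.1 + p.2 := by
        exact_mod_cast (Finset.HasAntidiagonal.mem_antidiagonal.1 hp).symm
      rw [show x + y - n = (x - p.1) + (y - p.2) by rw [hn]; ring, qNum_add hq0]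
      ring
    · rw [← hleft, ← hright, ← Finset.sum_add_distrib, Finset.mul_sum]
      refine Finset.sum_congr rfl fun p hp => ?_
      have hn : (n : ℝ) + 1 = p.2 + p.1 := by
        rw [add_comm (p.2 : ℝ)]
        exact_mod_cast (Finset.HasAntidiagonal.mem_antidiagonal.1 hp).symm
      rw [hn, qNum_add hq0]
      ring

theorem sum_bounded_tuples_succ (k n : ℕ) (f : (Fin (k + 1) → ℕ) → ℝ) :
    ∑ r ∈ (Fintype.piFinset fun _ : Fin (k + 1) => Finset.range (n + 1)).filter
        (fun r => ∑ i, r i ≤ n), f r =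
      ∑ p ∈ Finset.HasAntidiagonal.antidiagonal n,
        ∑ r ∈ (Fintype.piFinset fun _ : Fin k => Finset.range (p.2 + 1)).filter
          (fun r => ∑ i, r i ≤ p.2), f (Fin.cons p.1 r) := by
  have hmem : ∀ (l m : ℕ) (r : Fin l → ℕ),
      r ∈ (Fintype.piFinset fun _ : Fin l => Finset.range (m + 1)).filter
        (fun r => ∑ i, r i ≤ m) ↔ ∑ i, r i ≤ m := by
    intro l m r
    simp only [Finset.mem_filter, Fintype.mem_piFinset, Finset.mem_range, and_iff_right_iff_imp]
    intro h i
    have := Finset.single_le_sum (fun i _ => Nat.zero_le (r i)) (Finset.mem_univ i)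
    omega
  rw [Finset.sum_sigma']
  refine Finset.sum_bij' (fun r _ => ⟨(r 0, n - r 0), Fin.tail r⟩)
    (fun s _ => Fin.cons s.1.1 s.2) ?_ ?_ ?_ ?_ ?_
  · intro r hr
    rw [hmem, Fin.sum_univ_succ] at hr
    rw [Finset.mem_sigma, hmem, Finset.HasAntidiagonal.mem_antidiagonal]
    simp only [Fin.tail]
    omega
  · rintro ⟨⟨a, b⟩, r⟩ hs
    rw [Finset.mem_sigma, hmem, Finset.HasAntidiagonal.mem_antidiagonal] at hs
    rw [hmem, Fin.sum_univ_succ]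
    simp only [Fin.cons_zero, Fin.cons_succ] at hs ⊢
    omega
  · intro r _
    exact Fin.cons_self_tail r
  · rintro ⟨⟨a, b⟩, r⟩ hs
    rw [Finset.mem_sigma, Finset.HasAntidiagonal.mem_antidiagonal] at hs
    have hb : n - a = b := by have := hs.1; dsimp at this; omega
    subst hb
    simp
  · intro r _
    exact congrArg f (Fin.cons_self_tail r).symm

theorem qBinom_sum {q : ℝ} (hq0 : 0 < q) (hq1 : q ≠ 1) (n k : ℕ) (x : Fin (k + 1) → ℝ) :
    qBinom q (∑ j, x j) n =
      ∑ r ∈ (Fintype.piFinset fun _ : Fin k => Finset.range (n + 1)).filter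
          (fun r => ∑ i, r i ≤ n),
        q ^ (∑ j : Fin k,
              ((n : ℝ) -
                  ∑ i ∈ Finset.univ.filter (fun i : Fin k => (i : ℕ) ≤ (j : ℕ)), (r i : ℝ)) *
                (x j.castSucc - r j)) *
          ((∏ j : Fin k, qBinom q (x j.castSucc) (r j)) *
            qBinom q (x (Fin.last k)) (n - ∑ i, r i)) := by
  induction k generalizing n with
  | zero => simp
  | succ k ih =>
    rw [Fin.sum_univ_succ, qBinom_add hq0 hq1, sum_bounded_tuples_succ]
    refine Finset.sum_congr rfl fun p hp => ?_
    rw [ih p.2 (fun j => x j.succ), Finset.mul_sum, Finset.mul_sum]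
    refine Finset.sum_congr rfl fun r _ => ?_
    have hn : n = p.1 + p.2 := (Finset.HasAntidiagonal.mem_antidiagonal.1 hp).symm
    have hsub : n - (p.1 + ∑ i, r i) = p.2 - ∑ i, r i := by omega
    have hn' : (n : ℝ) = p.1 + p.2 := by exact_mod_cast hn
    simp only [Finset.sum_filter, Fin.sum_univ_succ, Fin.prod_univ_succ, Fin.cons_zero,
      Fin.cons_succ, Fin.castSucc_zero, Fin.val_zero, Fin.val_succ, Nat.zero_le, if_true,
      Nat.le_zero, Nat.succ_ne_zero, if_false, Finset.sum_const_zero, sub_zero,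
      Nat.add_le_add_iff_right, ← Fin.succ_castSucc, ← Fin.succ_last, hsub, hn',
      add_sub_add_left_eq_sub, Real.rpow_add hq0]
    ring

/-- Multivariate `q`-Cauchy formula (2.9):
`[x₁+⋯+x_{k+1}; n]_q = ∑ q^{∑_{j=1}^{k}(n−s_j)(x_j−r_j)} ∏_{j=1}^{k+1}[x_j; r_j]_q`,
summed over nonnegative integers `r₁,…,r_k` with `r₁+⋯+r_k ≤ n`, where `s_j = r₁+⋯+r_j`
and `r_{k+1} = n − s_k`. -/
theorem multivariate_qCauchy
    (n k : ℕ) (hn : 1 ≤ n) (hk : 1 ≤ k)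
    (q : ℝ) (hq0 : 0 < q) (hq1 : q ≠ 1) (x : Fin (k + 1) → ℝ) :
    qBinom q (∑ j, x j) n =
      ∑ r ∈ (Fintype.piFinset fun _ : Fin k => Finset.range (n + 1)).filter
          (fun r => ∑ i, r i ≤ n),
        q ^ (∑ j : Fin k,
              ((n : ℝ) -
                  ∑ i ∈ Finset.univ.filter (fun i : Fin k => (i : ℕ) ≤ (j : ℕ)), (r i : ℝ)) *
                (x j.castSucc - r j)) *
          ((∏ j : Fin k, qBinom q (x j.castSucc) (r j)) *
            qBinom q (x (Fin.last k)) (n - ∑ i, r i)) := by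
  exact qBinom_sum hq0 hq1 n k x
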